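/- arXiv:1609.06856 — 2 statements merged into one kernel-verified Lean document; each statement's English description precedes it below -/
import Mathlib

section
/- Uniform approximation on entropy balls: for every α ≥ 0, lim_{k → ∞} sup { sup_{t ∈ [0,t_f]} sup_{A ⊆ W Borel} |b^{δ_k}_t(ν)(A) − β_t(ν)(A)| : ν finite Borel measure on V with h(ν|μ_T) ≤ α } = 0, where δ_k = t_f/k. (Note that h(ν|μ_T) ≤ α forces ν ≪ μ_T, so β(ν) is defined; equivalently this says the two-step Picard approximations γ^δ(ν) of the process of frustrated transmitters γ(ν) converge uniformly over entropy balls.) -/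
open MeasureTheory Set Filter
open scoped ENNReal NNReal

noncomputable section

/-- Ambient space `ℝ × ℝ × ℝ^d` hosting `V = [0,t_f] × [0,1] × W`. -/
abbrev SpacePt (d : ℕ) := ℝ × ℝ × (Fin d → ℝ)

/-- The intensity measure `μ_T = μᵗ ⊗ Leb_{[0,1]} ⊗ μˢ`. -/
noncomputable def muT (d : ℕ) (μt : Measure ℝ) (μs : Measure (Fin d → ℝ)) :
    Measure (SpacePt d) :=
  μt.prod ((volume.restrict (Icc (0:ℝ) 1)).prod μs)

/-- Membership in `𝓛`: nondecreasing `[0,t_f] → [0,1]` vanishing at `0`. -/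
def memL (tf : ℝ) (β : Icc (0:ℝ) tf → ℝ) : Prop :=
  Monotone β ∧ (∀ s : Icc (0:ℝ) tf, (s : ℝ) = 0 → β s = 0) ∧ ∀ s, β s ∈ Icc (0:ℝ) 1

/-- `β_t(ν)(A) = ν {(s,u,x) ∈ V : s ≤ t, u ≥ β_s, x ∈ A}`; for `A = W` this is the
value `𝒯_ν(β)_t` of the integral operator `𝒯_ν`. -/
noncomputable def bMass (d : ℕ) (tf : ℝ) (ν : Measure (SpacePt d)) (β : Icc (0:ℝ) tf → ℝ)
    (t : ℝ) (A : Set (Fin d → ℝ)) : ℝ≥0∞ :=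
  ν {p : SpacePt d | ∃ h : p.1 ∈ Icc (0:ℝ) tf,
      p.1 ≤ t ∧ β ⟨p.1, h⟩ ≤ p.2.1 ∧ p.2.1 ∈ Icc (0:ℝ) 1 ∧ p.2.2 ∈ A}

/-- `β` is a fixed point of `𝒯_ν`, i.e. `β_t = ν {(s,u,x) ∈ V : s ≤ t, β_s ≤ u}`. -/
def IsFixedPt (d : ℕ) (tf : ℝ) (W : Set (Fin d → ℝ)) (ν : Measure (SpacePt d))
    (β : Icc (0:ℝ) tf → ℝ) : Prop :=
  ∀ t : Icc (0:ℝ) tf, ENNReal.ofReal (β t) = bMass d tf ν β (t : ℝ) W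

/-- `ν((nδ, (n+1)δ] × [0,1] × W)`. -/
noncomputable def slabMass (d : ℕ) (W : Set (Fin d → ℝ)) (ν : Measure (SpacePt d))
    (δ : ℝ) (n : ℕ) : ℝ≥0∞ :=
  ν {p : SpacePt d | p.1 ∈ Ioc ((n : ℝ) * δ) (((n : ℝ) + 1) * δ) ∧
      p.2.1 ∈ Icc (0:ℝ) 1 ∧ p.2.2 ∈ W}

/-- Value `b^δ_{nδ}(ν)(A)` of the two-step Picard scheme at the grid time `nδ`. -/
noncomputable def bGrid (d : ℕ) (W : Set (Fin d → ℝ)) (ν : Measure (SpacePt d)) (δ : ℝ) :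
    ℕ → Set (Fin d → ℝ) → ℝ
  | 0, _ => 0
  | n + 1, A =>
      bGrid d W ν δ n A +
        (ν {p : SpacePt d | p.1 ∈ Ioc ((n : ℝ) * δ) (((n : ℝ) + 1) * δ) ∧
            p.2.1 ∈ Icc (bGrid d W ν δ n W + (slabMass d W ν δ n).toReal) 1 ∧
            p.2.2 ∈ A}).toReal

/-- `b^{↑,δ}_t(ν) = b^δ_{(n-1)δ}(ν)(W) + ν(((n-1)δ, nδ] × [0,1] × W)` for
`t ∈ ((n-1)δ, nδ]`. -/
noncomputable def bUp (d : ℕ) (W : Set (Fin d → ℝ)) (ν : Measure (SpacePt d)) (δ : ℝ)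
    (t : ℝ) : ℝ :=
  bGrid d W ν δ (⌈t / δ⌉.toNat - 1) W + (slabMass d W ν δ (⌈t / δ⌉.toNat - 1)).toReal

/-- `b^δ_t(ν)(A) = b^δ_{(n-1)δ}(ν)(A) + ν(((n-1)δ, t] × [b^{↑,δ}_{nδ}(ν), 1] × A)` for
`t ∈ ((n-1)δ, nδ]`. -/
noncomputable def bDel (d : ℕ) (W : Set (Fin d → ℝ)) (ν : Measure (SpacePt d)) (δ : ℝ)
    (t : ℝ) (A : Set (Fin d → ℝ)) : ℝ :=
  bGrid d W ν δ (⌈t / δ⌉.toNat - 1) A +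
    (ν {p : SpacePt d | p.1 ∈ Ioc (((⌈t / δ⌉.toNat - 1 : ℕ) : ℝ) * δ) t ∧
        p.2.1 ∈ Icc (bUp d W ν δ t) 1 ∧ p.2.2 ∈ A}).toReal

/-- Relative entropy `h(ν|μ) = ∫ log(dν/dμ) dν − ν(S) + μ(S)` if `ν ≪ μ`, `∞` otherwise,
written as `∫ (r log r − r + 1) dμ` with `r = dν/dμ ≥ 0`, whose integrand is nonnegative. -/
noncomputable def relEnt {S : Type*} [MeasurableSpace S] (ν μ : Measure S) : ℝ≥0∞ :=
  letI := Classical.propDecidable (ν ≪ μ)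
  if ν ≪ μ then
    ∫⁻ x, ENNReal.ofReal
      ((ν.rnDeriv μ x).toReal * Real.log (ν.rnDeriv μ x).toReal
        - (ν.rnDeriv μ x).toReal + 1) ∂μ
  else ⊤

lemma entropy_pt (r c : ℝ) (hr : 0 ≤ r) :
    c * r ≤ (r * Real.log r - r + 1) + Real.exp c := by
  rcases hr.eq_or_lt with h | h
  · subst h; simp; positivity
  · have h1 := Real.add_one_le_exp (c - Real.log r)
    rw [Real.exp_sub, Real.exp_log h, le_div_iff₀ h] at h1
    nlinarith

lemma entropy_set {S : Type*} [MeasurableSpace S] (ν μ : Measure S) [IsFiniteMeasure ν]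
    [IsFiniteMeasure μ] (α : ℝ) (h : relEnt ν μ ≤ ENNReal.ofReal α) (c : ℝ) (hc : 0 ≤ c)
    (E : Set S) : ν ≪ μ ∧
    ENNReal.ofReal c * ν E ≤ ENNReal.ofReal α + ENNReal.ofReal (Real.exp c) * μ E := by
  have hac : ν ≪ μ := by
    by_contra hn
    simp [relEnt, hn] at h
  refine ⟨hac, ?_⟩
  have h' : ∫⁻ x, ENNReal.ofReal
      ((ν.rnDeriv μ x).toReal * Real.log (ν.rnDeriv μ x).toReal
        - (ν.rnDeriv μ x).toReal + 1) ∂μ ≤ ENNReal.ofReal α := by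
    simpa [relEnt, hac] using h
  rw [← Measure.setLIntegral_rnDeriv hac E,
    ← lintegral_const_mul _ (Measure.measurable_rnDeriv ν μ)]
  calc ∫⁻ x in E, ENNReal.ofReal c * ν.rnDeriv μ x ∂μ
      ≤ ∫⁻ x in E, (ENNReal.ofReal
      ((ν.rnDeriv μ x).toReal * Real.log (ν.rnDeriv μ x).toReal
        - (ν.rnDeriv μ x).toReal + 1) + ENNReal.ofReal (Real.exp c)) ∂μ := by
        apply lintegral_mono_ae
        filter_upwards [ae_restrict_of_ae (Measure.rnDeriv_lt_top ν μ)] with x hx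
        conv_lhs => rw [← ENNReal.ofReal_toReal hx.ne, ← ENNReal.ofReal_mul hc]
        refine le_trans (ENNReal.ofReal_le_ofReal (entropy_pt _ c ENNReal.toReal_nonneg)) ?_
        exact ENNReal.ofReal_add_le
    _ = (∫⁻ x in E, ENNReal.ofReal
      ((ν.rnDeriv μ x).toReal * Real.log (ν.rnDeriv μ x).toReal
        - (ν.rnDeriv μ x).toReal + 1) ∂μ) + ENNReal.ofReal (Real.exp c) * μ E := by
        rw [lintegral_add_right _ measurable_const, setLIntegral_const]
    _ ≤ _ := by
        gcongr
        exact (setLIntegral_le_lintegral _ _).trans h'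

/-- uniform absolute continuity on entropy balls -/
lemma entropy_uac {S : Type*} [MeasurableSpace S] (μ : Measure S)
    [IsFiniteMeasure μ] (α : ℝ) (hα : 0 ≤ α) (η : ℝ) (hη : 0 < η) :
    ∃ γ : ℝ, 0 < γ ∧ ∀ ν : Measure S, IsFiniteMeasure ν → relEnt ν μ ≤ ENNReal.ofReal α →
      ∀ E : Set S, μ E ≤ ENNReal.ofReal γ → ν.real E ≤ η := by
  set c : ℝ := 2 * α / η + 1 with hcdef
  have hc : 0 < c := by positivity
  refine ⟨η / 2 * Real.exp (-c), by positivity, ?_⟩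
  intro ν hν hent E hE
  obtain ⟨-, h⟩ := entropy_set ν μ α hent c hc.le E
  have h2 : ENNReal.ofReal c * ν E ≤ ENNReal.ofReal (α + Real.exp c * (η / 2 * Real.exp (-c))) := by
    rw [ENNReal.ofReal_add hα (by positivity), ENNReal.ofReal_mul (Real.exp_pos c).le]
    exact h.trans (by gcongr)
  have h3 := ENNReal.toReal_mono ENNReal.ofReal_ne_top h2
  rw [ENNReal.toReal_mul, ENNReal.toReal_ofReal hc.le, ENNReal.toReal_ofReal (by positivity)] at h3
  have h4 : Real.exp c * (η / 2 * Real.exp (-c)) = η / 2 := by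
    rw [Real.exp_neg]; field_simp
  rw [h4] at h3
  have h5 : c * η = 2 * α + η := by rw [hcdef]; field_simp
  change (ν E).toReal ≤ η
  by_contra hcon
  push Not at hcon
  have h6 := mul_lt_mul_of_pos_left hcon hc
  linarith

lemma comparison (T : ℝ) (p q : ℝ → ℝ) (hp : ContinuousOn p (Icc 0 T))
    (hq : ContinuousOn q (Icc 0 T)) (h0 : p 0 ≤ q 0)
    (hinc : ∀ s t, 0 ≤ s → s ≤ t → t ≤ T → (∀ r ∈ Ioc s t, q r < p r) →
      p t - p s ≤ q t - q s) : ∀ t ∈ Icc 0 T, p t ≤ q t := by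
  intro t ht
  set S := {r ∈ Icc 0 t | p r ≤ q r} with hS
  have hsub : Icc 0 t ⊆ Icc 0 T := Icc_subset_Icc_right ht.2
  have hcl : IsClosed S := isClosed_Icc.isClosed_le (hp.mono hsub) (hq.mono hsub)
  have hbd : BddAbove S := ⟨t, fun r hr => hr.1.2⟩
  have hmem : sSup S ∈ S := hcl.csSup_mem ⟨0, ⟨le_rfl, ht.1⟩, h0⟩ hbd
  have := hinc (sSup S) t hmem.1.1 hmem.1.2 ht.2 (by
    intro r hr
    by_contra hcon
    push Not at hcon
    have : r ∈ S := ⟨⟨hmem.1.1.trans hr.1.le, hr.2⟩, hcon⟩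
    exact absurd (le_csSup hbd this) (not_le.mpr hr.1))
  have := hmem.2
  linarith

def regC (d : ℕ) (θ : ℝ → ℝ) (A : Set (Fin d → ℝ)) : Set (SpacePt d) :=
  {p | θ p.1 ≤ p.2.1 ∧ p.2.1 ≤ 1 ∧ p.2.2 ∈ A}

lemma measurableSet_regC {d : ℕ} {θ : ℝ → ℝ} (hθ : Measurable θ) {A : Set (Fin d → ℝ)}
    (hA : MeasurableSet A) : MeasurableSet (regC d θ A) := by
  refine (measurableSet_le (hθ.comp measurable_fst) (measurable_fst.comp measurable_snd)).inter
    ((measurableSet_le (measurable_fst.comp measurable_snd) measurable_const).inter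
    ((measurable_snd.comp measurable_snd) hA))

def cyl (d : ℕ) (I : Set ℝ) : Set (SpacePt d) := {p | p.1 ∈ I}

lemma measurableSet_cyl {d : ℕ} {I : Set ℝ} (hI : MeasurableSet I) : MeasurableSet (cyl d I) :=
  measurable_fst hI

def G (d : ℕ) (ν : Measure (SpacePt d)) (θ : ℝ → ℝ) (A : Set (Fin d → ℝ)) (t : ℝ) : ℝ :=
  ν.real (cyl d (Ioc 0 t) ∩ regC d θ A)

lemma G_add {d : ℕ} (ν : Measure (SpacePt d)) [IsFiniteMeasure ν] {θ : ℝ → ℝ}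
    (hθ : Measurable θ) {A : Set (Fin d → ℝ)} (hA : MeasurableSet A) {s t : ℝ} (hs : 0 ≤ s)
    (hst : s ≤ t) : G d ν θ A t = G d ν θ A s + ν.real (cyl d (Ioc s t) ∩ regC d θ A) := by
  unfold G
  rw [← measureReal_union _ ((measurableSet_cyl measurableSet_Ioc).inter
    (measurableSet_regC hθ hA)), ← union_inter_distrib_right]
  · congr 2
    change _ = {p : SpacePt d | p.1 ∈ Ioc 0 s} ∪ {p : SpacePt d | p.1 ∈ Ioc s t}
    rw [← ofPred_or]
    simp only [← mem_union, Ioc_union_Ioc_eq_Ioc hs hst]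
    rfl
  · rw [Set.disjoint_left]
    rintro p ⟨h1, -⟩ ⟨h2, -⟩
    exact absurd h1.2 (not_le.mpr h2.1)

lemma G_cont {d : ℕ} (ν : Measure (SpacePt d)) [IsFiniteMeasure ν] {θ : ℝ → ℝ}
    (hθ : Measurable θ) {A : Set (Fin d → ℝ)} (hA : MeasurableSet A)
    (hat : ∀ x, ν (cyl d {x}) = 0) (T : ℝ) : ContinuousOn (G d ν θ A) (Icc 0 T) := by
  set τ : Measure ℝ := (ν.restrict (regC d θ A)).map Prod.fst with hτ
  have : IsFiniteMeasure τ := by rw [hτ]; infer_instance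
  have : NullSingletonClass τ := ⟨fun x => by
    rw [hτ, Measure.map_apply measurable_fst (measurableSet_singleton x)]
    exact le_antisymm ((Measure.restrict_apply_le _ _).trans (hat x).le) bot_le⟩
  have hc : Continuous (fun t => ∫ x in (0:ℝ)..t, (1:ℝ) ∂τ) :=
    intervalIntegral.continuous_primitive (fun a b => by
      exact ⟨integrable_const _, integrable_const _⟩) 0
  refine hc.continuousOn.congr ?_
  intro t ht
  change _ = ∫ x in (0:ℝ)..t, (1:ℝ) ∂τ
  rw [intervalIntegral.integral_of_le ht.1, setIntegral_const]
  simp only [smul_eq_mul, mul_one]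
  rw [hτ, map_measureReal_apply measurable_fst measurableSet_Ioc,
    measureReal_restrict_apply (measurable_fst measurableSet_Ioc)]
  rfl

section scheme
variable {d : ℕ} {W : Set (Fin d → ℝ)} {ν : Measure (SpacePt d)} {δ : ℝ}

lemma bUp_eq (hδ : 0 < δ) (n : ℕ) {r : ℝ} (hr : r ∈ Ioc ((n:ℝ) * δ) (((n:ℝ) + 1) * δ)) :
    ⌈r / δ⌉.toNat - 1 = n := by
  have : ⌈r / δ⌉ = (n:ℤ) + 1 := by
    rw [Int.ceil_eq_iff]
    push_cast
    refine ⟨?_, ?_⟩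
    · rw [lt_div_iff₀ hδ]; linarith [hr.1]
    · rw [div_le_iff₀ hδ]; exact hr.2
  omega

lemma exists_slab (hδ : 0 < δ) {r : ℝ} (hr : 0 < r) :
    ∃ n : ℕ, r ∈ Ioc ((n:ℝ) * δ) (((n:ℝ) + 1) * δ) := by
  have h1 : 0 < ⌈r / δ⌉ := Int.ceil_pos.mpr (by positivity)
  refine ⟨(⌈r / δ⌉ - 1).toNat, ?_⟩
  have h2 : (((⌈r / δ⌉ - 1).toNat : ℕ) : ℝ) = (⌈r / δ⌉ : ℝ) - 1 := by
    have : (((⌈r / δ⌉ - 1).toNat : ℕ) : ℤ) = ⌈r / δ⌉ - 1 := Int.toNat_of_nonneg (by omega)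
    exact_mod_cast congrArg (Int.cast : ℤ → ℝ) this
  rw [h2]
  have h3 := Int.ceil_lt_add_one (r / δ)
  have h4 := Int.le_ceil (r / δ)
  rw [div_le_iff₀ hδ] at h4
  refine ⟨?_, by linarith⟩
  rw [← lt_div_iff₀ hδ]; linarith

lemma bUp_meas : Measurable (bUp d W ν δ) := by
  have h : Measurable (fun z : ℤ => bGrid d W ν δ (z.toNat - 1) W
      + (slabMass d W ν δ (z.toNat - 1)).toReal) := measurable_from_top
  exact h.comp (Int.measurable_ceil.comp (measurable_id.div_const δ))

lemma bGrid_nonneg (n : ℕ) (A : Set (Fin d → ℝ)) : 0 ≤ bGrid d W ν δ n A := by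
  induction n with
  | zero => simp [bGrid]
  | succ n ih => rw [bGrid]; positivity

lemma bUp_nonneg (r : ℝ) : 0 ≤ bUp d W ν δ r :=
  add_nonneg (bGrid_nonneg _ _) ENNReal.toReal_nonneg

lemma piece_eq (hδ : 0 < δ) (n : ℕ) {t : ℝ} (ht : t ≤ ((n:ℝ) + 1) * δ) (A : Set (Fin d → ℝ)) :
    {p : SpacePt d | p.1 ∈ Ioc ((n : ℝ) * δ) t ∧
            p.2.1 ∈ Icc (bGrid d W ν δ n W + (slabMass d W ν δ n).toReal) 1 ∧
            p.2.2 ∈ A} = cyl d (Ioc ((n:ℝ) * δ) t) ∩ regC d (bUp d W ν δ) A := by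
  ext p
  simp only [mem_ofPred_eq, cyl, regC, mem_inter_iff]
  constructor
  · rintro ⟨h1, h2, h3⟩
    refine ⟨h1, ?_, h2.2, h3⟩
    rw [bUp, bUp_eq hδ n ⟨h1.1, h1.2.trans ht⟩]
    exact h2.1
  · rintro ⟨h1, h2, h3, h4⟩
    rw [bUp, bUp_eq hδ n ⟨h1.1, h1.2.trans ht⟩] at h2
    exact ⟨h1, ⟨h2, h3⟩, h4⟩

lemma bGrid_eq [IsFiniteMeasure ν] (hδ : 0 < δ) {A : Set (Fin d → ℝ)} (hA : MeasurableSet A)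
    (n : ℕ) : bGrid d W ν δ n A = G d ν (bUp d W ν δ) A ((n:ℝ) * δ) := by
  induction n with
  | zero => simp [bGrid, G, cyl]
  | succ n ih =>
    rw [bGrid, piece_eq hδ n le_rfl, ih]
    push_cast
    rw [G_add ν bUp_meas hA (s := (n:ℝ) * δ) (t := ((n:ℝ) + 1) * δ) (by positivity) (by nlinarith)]
    rfl

lemma bDel_eq [IsFiniteMeasure ν] (hδ : 0 < δ) {A : Set (Fin d → ℝ)} (hA : MeasurableSet A)
    {t : ℝ} (ht : 0 ≤ t) : bDel d W ν δ t A = G d ν (bUp d W ν δ) A t := by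
  rcases ht.eq_or_lt with h | h
  · subst h
    simp [bDel, bGrid, G, cyl]
  · obtain ⟨n, hn⟩ := exists_slab hδ h
    rw [bDel, bUp, bUp_eq hδ n hn, piece_eq hδ n hn.2, bGrid_eq hδ hA,
      G_add ν bUp_meas hA (s := (n:ℝ) * δ) (by positivity) hn.1.le]
    rfl

lemma bUp_bounds [IsFiniteMeasure ν] (hδ : 0 < δ) (hW : MeasurableSet W) {κ : ℝ}
    (hκ : ∀ n : ℕ, ν.real (cyl d (Ioc ((n:ℝ) * δ) (((n:ℝ) + 1) * δ))) ≤ κ)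
    {r : ℝ} (hr : 0 < r) :
    G d ν (bUp d W ν δ) W r ≤ bUp d W ν δ r ∧
      bUp d W ν δ r ≤ G d ν (bUp d W ν δ) W r + κ := by
  obtain ⟨n, hn⟩ := exists_slab hδ hr
  have h1 := G_add ν (bUp_meas (d := d) (W := W) (ν := ν) (δ := δ)) hW
    (s := (n:ℝ) * δ) (by positivity) hn.1.le
  have h2 : bUp d W ν δ r = G d ν (bUp d W ν δ) W ((n:ℝ) * δ) + (slabMass d W ν δ n).toReal := by
    conv_lhs => rw [bUp, bUp_eq hδ n hn, bGrid_eq hδ hW]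
  have h3 : (slabMass d W ν δ n).toReal ≤ κ := by
    refine le_trans ?_ (hκ n)
    exact measureReal_mono (fun p hp => hp.1)
  have h4 : ν.real (cyl d (Ioc ((n:ℝ) * δ) r) ∩ regC d (bUp d W ν δ) W)
      ≤ (slabMass d W ν δ n).toReal := by
    refine measureReal_mono ?_
    rintro p ⟨hp1, hp2, hp3, hp4⟩
    exact ⟨⟨hp1.1, hp1.2.trans hn.2⟩, ⟨(bUp_nonneg _).trans hp2, hp3⟩, hp4⟩
  have h5 : 0 ≤ ν.real (cyl d (Ioc ((n:ℝ) * δ) r) ∩ regC d (bUp d W ν δ) W) :=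
    measureReal_nonneg
  constructor <;> linarith
end scheme

lemma G_inc {d : ℕ} (ν : Measure (SpacePt d)) [IsFiniteMeasure ν] {θ₁ θ₂ : ℝ → ℝ}
    (h₁ : Measurable θ₁) (h₂ : Measurable θ₂) {A : Set (Fin d → ℝ)} (hA : MeasurableSet A)
    {s t : ℝ} (hs : 0 ≤ s) (hst : s ≤ t) (h : ∀ r ∈ Ioc s t, θ₂ r ≤ θ₁ r) :
    G d ν θ₁ A t - G d ν θ₁ A s ≤ G d ν θ₂ A t - G d ν θ₂ A s := by
  rw [G_add ν h₁ hA hs hst, G_add ν h₂ hA hs hst]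
  have : ν.real (cyl d (Ioc s t) ∩ regC d θ₁ A) ≤ ν.real (cyl d (Ioc s t) ∩ regC d θ₂ A) := by
    refine measureReal_mono ?_
    rintro p ⟨hp1, hp2, hp3⟩
    exact ⟨hp1, (h _ hp1).trans hp2, hp3⟩
  linarith

lemma bMass_eq {d : ℕ} {tf : ℝ} (ν : Measure (SpacePt d)) (htf : 0 ≤ tf)
    {β : Icc (0:ℝ) tf → ℝ} (hβ : ∀ s, 0 ≤ β s) (hat : ν (cyl d {0}) = 0)
    (A : Set (Fin d → ℝ)) {t : ℝ} (ht : t ≤ tf) :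
    (bMass d tf ν β t A).toReal = G d ν (fun r => β (projIcc 0 tf htf r)) A t := by
  unfold bMass G Measure.real
  congr 1
  apply le_antisymm
  · refine le_trans (measure_mono (t := cyl d {0} ∪
      (cyl d (Ioc 0 t) ∩ regC d (fun r => β (projIcc 0 tf htf r)) A)) ?_) ?_
    · rintro p ⟨h, h1, h2, h3, h4⟩
      rcases h.1.eq_or_lt with h0 | h0
      · left; exact h0.symm
      · right
        refine ⟨⟨h0, h1⟩, ?_, h3.2, h4⟩
        simpa [projIcc_of_mem htf h] using h2
    · refine (measure_union_le _ _).trans ?_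
      rw [hat, zero_add]
  · refine measure_mono ?_
    rintro p ⟨h1, h2, h3, h4⟩
    have h : p.1 ∈ Icc 0 tf := ⟨h1.1.le, h1.2.trans ht⟩
    have h2' : β ⟨p.1, h⟩ ≤ p.2.1 := by simpa [projIcc_of_mem htf h] using h2
    exact ⟨h, h1.2, h2', ⟨(hβ _).trans h2', h3⟩, h4⟩

instance (d : ℕ) (μt : Measure ℝ) (μs : Measure (Fin d → ℝ)) [IsFiniteMeasure μt]
    [IsFiniteMeasure μs] : IsFiniteMeasure (muT d μt μs) := by
  unfold muT; infer_instance

lemma muT_strip {d : ℕ} (μt : Measure ℝ) (μs : Measure (Fin d → ℝ)) [IsFiniteMeasure μt]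
    [IsFiniteMeasure μs] {B : ℝ → ℝ} (hB : Measurable B) (κ : ℝ) (hκ : 0 ≤ κ) :
    muT d μt μs {p | |p.2.1 - B p.1| ≤ κ} ≤
      ENNReal.ofReal (2 * κ * (μs.real univ * μt.real univ)) := by
  have hm : MeasurableSet {p : SpacePt d | |p.2.1 - B p.1| ≤ κ} := by
    refine measurableSet_le ?_ measurable_const
    exact (((measurable_fst.comp measurable_snd).sub (hB.comp measurable_fst))).abs
  unfold muT
  rw [Measure.prod_apply hm]
  calc _ ≤ ∫⁻ _s, ENNReal.ofReal (2 * κ) * μs univ ∂μt := by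
        refine lintegral_mono fun s => ?_
        have : (Prod.mk s ⁻¹' {p : SpacePt d | |p.2.1 - B p.1| ≤ κ})
            = Icc (B s - κ) (B s + κ) ×ˢ univ := by
          ext q
          simp only [mem_preimage, mem_ofPred_eq, mem_prod, mem_univ, and_true, mem_Icc, abs_le]
          constructor <;> rintro ⟨h1, h2⟩ <;> constructor <;> linarith
        rw [this, Measure.prod_prod]
        gcongr
        refine (Measure.restrict_apply_le _ _).trans ?_
        rw [Real.volume_Icc]
        apply ENNReal.ofReal_le_ofReal; linarith
    _ = _ := by
        rw [lintegral_const, ENNReal.ofReal_mul (p := 2 * κ) (by positivity),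
          ENNReal.ofReal_mul measureReal_nonneg]
        rw [ofReal_measureReal, ofReal_measureReal, mul_assoc]

lemma muT_cyl {d : ℕ} (μt : Measure ℝ) (μs : Measure (Fin d → ℝ)) [IsFiniteMeasure μt]
    [IsFiniteMeasure μs] (I : Set ℝ) :
    muT d μt μs (cyl d I) = μt I * μs univ := by
  have : cyl d I = I ×ˢ (univ ×ˢ univ) := by ext p; simp [cyl]
  rw [this, muT, Measure.prod_prod, Measure.prod_prod]
  simp

lemma ac_small (μt : Measure ℝ) [IsFiniteMeasure μt] (hac : μt ≪ (volume : Measure ℝ))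
    (γ : ℝ) (hγ : 0 < γ) : ∃ δ : ℝ, 0 < δ ∧ ∀ I : Set ℝ, volume I ≤ ENNReal.ofReal δ →
      μt I ≤ ENNReal.ofReal γ := by
  obtain ⟨δ, hδ, h⟩ := exists_pos_setLIntegral_lt_of_measure_lt (μ := (volume : Measure ℝ))
    (f := μt.rnDeriv volume) (by
      rw [Measure.lintegral_rnDeriv hac]; exact measure_ne_top _ _)
    (ε := ENNReal.ofReal γ) (by simpa using hγ)
  obtain ⟨δ', h1, h2⟩ := exists_between hδ
  have hne : δ' ≠ ⊤ := h2.ne_top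
  refine ⟨δ'.toReal, ENNReal.toReal_pos h1.ne' hne, fun I hI => ?_⟩
  rw [ENNReal.ofReal_toReal hne] at hI
  have := h I (hI.trans_lt h2)
  rw [Measure.setLIntegral_rnDeriv hac] at this
  exact this.le

/-- Uniform approximation on entropy balls: for every `α ≥ 0`,
`limsup_{k → ∞} sup { ‖b^{δ_k}(ν) − β(ν)‖ : h(ν|μ_T) ≤ α } = 0` with `δ_k = t_f/k`. -/
theorem statement5
    (tf : ℝ) (htf : 0 < tf) (d : ℕ) (W : Set (Fin d → ℝ)) (hW : IsCompact W)
    (μt : Measure ℝ) [IsFiniteMeasure μt] (hμt_ac : μt ≪ (volume : Measure ℝ))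
    (hμt_supp : μt (Icc (0:ℝ) tf)ᶜ = 0)
    (μs : Measure (Fin d → ℝ)) [IsFiniteMeasure μs]
    (hμs_ac : μs ≪ (volume : Measure (Fin d → ℝ))) (hμs_supp : μs Wᶜ = 0)
    (α : ℝ) (hα : 0 ≤ α) :
    ∀ ε : ℝ, 0 < ε → ∃ K : ℕ, ∀ k : ℕ, K ≤ k → 0 < k →
      ∀ ν : Measure (SpacePt d), IsFiniteMeasure ν →
        relEnt ν (muT d μt μs) ≤ ENNReal.ofReal α →
        ∀ β : Icc (0:ℝ) tf → ℝ, memL tf β → IsFixedPt d tf W ν β →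
          ∀ t : Icc (0:ℝ) tf, ∀ A : Set (Fin d → ℝ), MeasurableSet A → A ⊆ W →
            |bDel d W ν (tf / k) (t : ℝ) A - (bMass d tf ν β (t : ℝ) A).toReal| ≤ ε := by
  intro ε hε
  obtain ⟨γ, hγ, H1⟩ := entropy_uac (muT d μt μs) α hα ε hε
  set m : ℝ := μs.real univ * μt.real univ with hm
  have hm0 : 0 ≤ m := mul_nonneg measureReal_nonneg measureReal_nonneg
  set κ : ℝ := γ / (2 * (m + 1)) with hκd
  have hκ : 0 < κ := by positivity
  have hκm : 2 * κ * m ≤ γ := by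
    have : 2 * κ * (m + 1) = γ := by rw [hκd]; field_simp
    nlinarith
  obtain ⟨γ₂, hγ₂, H2⟩ := entropy_uac (muT d μt μs) α hα κ hκ
  obtain ⟨δ₀, hδ₀, H3⟩ := ac_small μt hμt_ac (γ₂ / (μs.real univ + 1))
    (div_pos hγ₂ (by have := measureReal_nonneg (μ := μs) (s := univ); linarith))
  obtain ⟨K, hK⟩ := exists_nat_gt (tf / δ₀)
  refine ⟨K, fun k hKk hk ν hν hent β hβ hfix t A hA hAW => ?_⟩
  have hkR : (0:ℝ) < k := by exact_mod_cast hk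
  have hδ : 0 < tf / k := by positivity
  have hδle : tf / k ≤ δ₀ := by
    have : (K:ℝ) ≤ k := by exact_mod_cast hKk
    rw [div_lt_iff₀ hδ₀] at hK
    rw [div_le_iff₀ hkR]
    nlinarith
  have hWm : MeasurableSet W := hW.isClosed.measurableSet
  have hac : ν ≪ muT d μt μs := (entropy_set ν _ α hent 0 le_rfl ∅).1
  have hat : ∀ x, ν (cyl d {x}) = 0 := fun x => hac (by
    rw [muT_cyl, hμt_ac (by simp), zero_mul])
  have hslab : ∀ n : ℕ, ν.real (cyl d (Ioc ((n:ℝ) * (tf / k)) (((n:ℝ) + 1) * (tf / k)))) ≤ κ := by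
    intro n
    refine H2 ν hν hent _ ?_
    have h3 := H3 (Ioc ((n:ℝ) * (tf / k)) (((n:ℝ) + 1) * (tf / k))) (by
      rw [Real.volume_Ioc]; apply ENNReal.ofReal_le_ofReal; linarith)
    have hs0 := measureReal_nonneg (μ := μs) (s := univ)
    rw [muT_cyl]
    calc _ ≤ ENNReal.ofReal (γ₂ / (μs.real univ + 1)) * ENNReal.ofReal (μs.real univ) := by
          rw [ofReal_measureReal]; gcongr
      _ = ENNReal.ofReal (γ₂ / (μs.real univ + 1) * μs.real univ) := by
          rw [ENNReal.ofReal_mul (by positivity)]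
      _ ≤ _ := by
          apply ENNReal.ofReal_le_ofReal
          rw [div_mul_eq_mul_div, div_le_iff₀ (by linarith)]
          nlinarith
  obtain ⟨hmono, hzero, hrange⟩ := hβ
  set B : ℝ → ℝ := fun r => β (projIcc 0 tf htf.le r) with hB
  have hBm : Measurable B := (hmono.comp (monotone_projIcc htf.le)).measurable
  set U : ℝ → ℝ := bUp d W ν (tf / k) with hU
  have hUm : Measurable U := bUp_meas
  have hbm : ∀ (A : Set (Fin d → ℝ)) {t : ℝ}, t ≤ tf →
      (bMass d tf ν β t A).toReal = G d ν B A t := fun A t ht =>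
    bMass_eq ν htf.le (fun s => (hrange s).1) (hat 0) A ht
  have hBG : ∀ r ∈ Icc 0 tf, B r = G d ν B W r := by
    intro r hr
    rw [← hbm W hr.2, ← hfix ⟨r, hr⟩, ENNReal.toReal_ofReal (hrange _).1, hB]
    simp [projIcc_of_mem htf.le hr]
  have hUb : ∀ {r : ℝ}, 0 < r → G d ν U W r ≤ U r ∧ U r ≤ G d ν U W r + κ :=
    fun hr => bUp_bounds hδ hWm hslab hr
  have hG0 : ∀ θ, G d ν θ W 0 = 0 := fun θ => by simp [G, cyl]
  have hcU := G_cont ν hUm hWm hat tf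
  have hcB := G_cont ν hBm hWm hat tf
  have c1 : ∀ r ∈ Icc 0 tf, G d ν U W r ≤ G d ν B W r := by
    refine comparison tf _ _ hcU hcB (by rw [hG0, hG0]) ?_
    intro s t hs hst ht hr
    refine G_inc ν hUm hBm hWm hs hst fun r hrr => ?_
    have h0 : 0 < r := hs.trans_lt hrr.1
    rw [hBG r ⟨h0.le, hrr.2.trans ht⟩]
    exact (hr r hrr).le.trans (hUb h0).1
  have c2 : ∀ r ∈ Icc 0 tf, G d ν B W r ≤ G d ν U W r + κ := by
    refine comparison tf _ (fun r => G d ν U W r + κ) hcB (hcU.add continuousOn_const)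
      (by simp only [hG0]; linarith) ?_
    intro s t hs hst ht hr
    have := G_inc ν hBm hUm hWm hs hst fun r hrr => by
      have h0 : 0 < r := hs.trans_lt hrr.1
      rw [hBG r ⟨h0.le, hrr.2.trans ht⟩]
      exact (hUb h0).2.trans (hr r hrr).le
    linarith
  have hUB : ∀ r ∈ Ioc 0 tf, |U r - B r| ≤ κ := by
    intro r hr
    have hr' : r ∈ Icc 0 tf := ⟨hr.1.le, hr.2⟩
    have h1 := c1 r hr'
    have h2 := c2 r hr'
    have h3 := hUb hr.1
    rw [hBG r hr', abs_le]
    constructor <;> linarith [h3.1, h3.2]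
  rw [bDel_eq hδ hA t.2.1, hbm A t.2.2]
  set D : Set (SpacePt d) := {p | |p.2.1 - B p.1| ≤ κ} with hD
  have hDν : ν.real D ≤ ε := H1 ν hν hent D ((muT_strip μt μs hBm κ hκ.le).trans
    (ENNReal.ofReal_le_ofReal hκm))
  have e1 : G d ν U A t ≤ G d ν B A t + ν.real D := by
    refine le_trans (measureReal_mono ?_) (measureReal_union_le _ _)
    rintro p ⟨h1, h2, h3⟩
    have h4 := abs_le.1 (hUB p.1 ⟨h1.1, h1.2.trans t.2.2⟩)
    by_cases h : B p.1 ≤ p.2.1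
    · exact Or.inl ⟨h1, h, h3⟩
    · right
      rw [hD, mem_ofPred_eq, abs_le]
      push Not at h
      constructor <;> linarith [h4.1, h4.2]
  have e2 : G d ν B A t ≤ G d ν U A t + ν.real D := by
    refine le_trans (measureReal_mono ?_) (measureReal_union_le _ _)
    rintro p ⟨h1, h2, h3⟩
    have h4 := abs_le.1 (hUB p.1 ⟨h1.1, h1.2.trans t.2.2⟩)
    by_cases h : U p.1 ≤ p.2.1
    · exact Or.inl ⟨h1, h, h3⟩
    · right
      rw [hD, mem_ofPred_eq, abs_le]
      push Not at h
      constructor <;> linarith [h4.1, h4.2]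
  rw [abs_le]
  constructor <;> linarith

end
end

section
/- Entropy contraction under sub-graph restriction: let (Z,𝒵) be a measurable space, μ' a finite measure on Z, K > 0, and κ : Z → [0,K] measurable. Let μ* = μ' ⊗ Leb_{[0,K]} on Z × [0,K], and for a finite measure n* on Z × [0,K] let R(n*) be the pushforward under (z,v) ↦ z of the restriction of n* to the sub-graph {(z,v) : v ≤ κ(z)}. Let μ_κ be the measure on Z with dμ_κ/dμ' = κ. Then for every finite measure n on Z: inf { h(n*|μ*) : n* a finite measure on Z × [0,K] with R(n*) = n } = h(n|μ_κ). -/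
open MeasureTheory Set Filter
open scoped ENNReal NNReal Topology

noncomputable section

open InformationTheory in
lemma relEnt_of_ac {S : Type*} [MeasurableSpace S] {ν μ : Measure S} (h : ν ≪ μ) :
    relEnt ν μ = ∫⁻ x, ENNReal.ofReal (klFun (ν.rnDeriv μ x).toReal) ∂μ := by
  unfold relEnt
  rw [if_pos h]
  refine lintegral_congr fun x => ?_
  congr 1
  rw [klFun_apply]
  ring

open InformationTheory in
lemma relEnt_eq_klDiv {S : Type*} [MeasurableSpace S] (ν μ : Measure S)
    [IsFiniteMeasure ν] [IsFiniteMeasure μ] : relEnt ν μ = klDiv ν μ := by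
  by_cases h : ν ≪ μ
  · rw [relEnt_of_ac h, klDiv_eq_lintegral_klFun_of_ac h]
  · rw [klDiv_of_not_ac h]
    unfold relEnt
    rw [if_neg h]

lemma relEnt_restrict_le {S : Type*} [MeasurableSpace S] (ν μ : Measure S)
    [IsFiniteMeasure ν] [IsFiniteMeasure μ] {A : Set S} (hA : MeasurableSet A) :
    relEnt (ν.restrict A) (μ.restrict A) ≤ relEnt ν μ := by
  by_cases h : ν ≪ μ
  · rw [relEnt_of_ac h, relEnt_of_ac (h.restrict A)]
    have hd : (ν.restrict A).rnDeriv (μ.restrict A) =ᵐ[μ.restrict A] ν.rnDeriv μ := by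
      have e : ν.restrict A = (μ.restrict A).withDensity (ν.rnDeriv μ) := by
        rw [← restrict_withDensity hA, Measure.withDensity_rnDeriv_eq _ _ h]
      conv_lhs => rw [e]
      exact Measure.rnDeriv_withDensity _ (Measure.measurable_rnDeriv _ _)
    calc _ = ∫⁻ x in A, ENNReal.ofReal (InformationTheory.klFun (ν.rnDeriv μ x).toReal) ∂μ := by
          refine lintegral_congr_ae ?_
          filter_upwards [hd] with x hx
          rw [hx]
      _ ≤ _ := setLIntegral_le_lintegral _ _
  · have : relEnt ν μ = ⊤ := by
      unfold relEnt
      rw [if_neg h]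
    rw [this]
    exact le_top

lemma subgraph_meas {Z : Type*} [MeasurableSpace Z] (κ : Z → ℝ) (hκ : Measurable κ) :
    MeasurableSet {p : Z × ℝ | p.2 ∈ Icc 0 (κ p.1)} :=
  (measurableSet_le measurable_const measurable_snd).inter
    (measurableSet_le measurable_snd (hκ.comp measurable_fst))

lemma map_subgraph {Z : Type*} [MeasurableSpace Z] (μ' : Measure Z) [IsFiniteMeasure μ']
    (K : ℝ) (κ : Z → ℝ) (hκ_meas : Measurable κ)
    (hκ_range : ∀ z, κ z ∈ Icc (0:ℝ) K) :
    Measure.map Prod.fst ((μ'.prod (volume.restrict (Icc (0:ℝ) K))).restrict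
      {p : Z × ℝ | p.2 ∈ Icc 0 (κ p.1)}) = μ'.withDensity fun z => ENNReal.ofReal (κ z) := by
  have hS := subgraph_meas κ hκ_meas
  ext A hA
  rw [Measure.map_apply measurable_fst hA, Measure.restrict_apply (measurable_fst hA),
    Measure.prod_apply ((measurable_fst hA).inter hS), withDensity_apply _ hA,
    ← lintegral_indicator hA]
  refine lintegral_congr fun z => ?_
  by_cases hz : z ∈ A
  · rw [indicator_of_mem hz]
    have : Prod.mk z ⁻¹' (Prod.fst ⁻¹' A ∩ {p : Z × ℝ | p.2 ∈ Icc 0 (κ p.1)}) = Icc 0 (κ z) := by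
      ext v
      simp [hz]
    rw [this, Measure.restrict_apply measurableSet_Icc,
      inter_eq_self_of_subset_left (Icc_subset_Icc_right (hκ_range z).2)]
    simp
  · rw [indicator_of_notMem hz]
    have : Prod.mk z ⁻¹' (Prod.fst ⁻¹' A ∩ {p : Z × ℝ | p.2 ∈ Icc 0 (κ p.1)}) = ∅ := by
      ext v
      simp [hz]
    rw [this, measure_empty]

/-- Entropy contraction under sub-graph restriction: with
`μ* = μ' ⊗ Leb_{[0,K]}`, `R(n*)` the first-coordinate pushforward of the restriction of `n*`
to the sub-graph of `κ`, and `dμ_κ/dμ' = κ`, one has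
`inf { h(n*|μ*) : R(n*) = n } = h(n|μ_κ)` for every finite measure `n` on `Z`. -/
theorem statement18 {Z : Type*} [MeasurableSpace Z] (μ' : Measure Z) [IsFiniteMeasure μ']
    (K : ℝ) (hK : 0 < K) (κ : Z → ℝ) (hκ_meas : Measurable κ)
    (hκ_range : ∀ z, κ z ∈ Icc (0:ℝ) K)
    (n : Measure Z) [IsFiniteMeasure n] :
    ⨅ (n' : Measure (Z × ℝ)) (_ : IsFiniteMeasure n')
        (_ : Measure.map Prod.fst (n'.restrict {p : Z × ℝ | p.2 ∈ Icc 0 (κ p.1)}) = n),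
      relEnt n' (μ'.prod (volume.restrict (Icc (0:ℝ) K))) =
    relEnt n (μ'.withDensity fun z => ENNReal.ofReal (κ z)) := by
  have hS := subgraph_meas κ hκ_meas
  have hmap := map_subgraph μ' K κ hκ_meas hκ_range
  set S := {p : Z × ℝ | p.2 ∈ Icc 0 (κ p.1)} with hSdef
  set M := μ'.prod (volume.restrict (Icc (0:ℝ) K)) with hM
  rw [← hmap]
  apply le_antisymm
  · by_cases h : n ≪ Measure.map Prod.fst (M.restrict S)
    swap
    · have : relEnt n (Measure.map Prod.fst (M.restrict S)) = ⊤ := by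
        unfold relEnt
        rw [if_neg h]
      rw [this]
      exact le_top
    set Q := Measure.map Prod.fst (M.restrict S) with hQ
    set f := n.rnDeriv Q with hf
    have hfm : Measurable f := Measure.measurable_rnDeriv _ _
    classical
    let g : Z × ℝ → ℝ≥0∞ := S.piecewise (fun p => f p.1) (fun _ => 1)
    have hgm : Measurable g := Measurable.piecewise hS (hfm.comp measurable_fst) measurable_const
    have hgS : ∀ p ∈ S, g p = f p.1 := fun p hp => piecewise_eq_of_mem _ _ _ hp
    have hgSc : ∀ p ∈ Sᶜ, g p = 1 := fun p hp => piecewise_eq_of_notMem _ _ _ hp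
    have hlin : ∫⁻ p, g p ∂M ≠ ⊤ := by
      rw [← lintegral_add_compl _ hS, setLIntegral_congr_fun hS hgS,
        setLIntegral_congr_fun hS.compl hgSc,
        ← lintegral_map hfm measurable_fst, ← hQ]
      have : ∫⁻ z, f z ∂Q ≠ ⊤ := (Measure.lintegral_rnDeriv_lt_top n Q).ne
      simp [this]
    have hfin : IsFiniteMeasure (M.withDensity g) := isFiniteMeasure_withDensity hlin
    have hR : Measure.map Prod.fst ((M.withDensity g).restrict S) = n := by
      conv_rhs => rw [← Measure.withDensity_rnDeriv_eq n Q h]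
      ext A hA
      rw [Measure.map_apply measurable_fst hA, restrict_withDensity hS,
        withDensity_apply _ (measurable_fst hA), withDensity_apply _ hA, hQ,
        setLIntegral_map hA hfm measurable_fst]
      refine lintegral_congr_ae (ae_restrict_of_ae ?_)
      filter_upwards [ae_restrict_mem hS] with p hp using hgS p hp
    refine (iInf_le_of_le (M.withDensity g) (iInf_le_of_le hfin (iInf_le_of_le hR ?_)))
    have hk : Measurable fun x : ℝ≥0∞ => ENNReal.ofReal (InformationTheory.klFun x.toReal) :=
      (InformationTheory.measurable_klFun.comp ENNReal.measurable_toReal).ennreal_ofReal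
    rw [relEnt_of_ac h, relEnt_of_ac (withDensity_absolutelyContinuous _ _)]
    have h0 : ∫⁻ z, ENNReal.ofReal (InformationTheory.klFun (f z).toReal) ∂Q
        = ∫⁻ p in S, ENNReal.ofReal (InformationTheory.klFun (f p.1).toReal) ∂M :=
      lintegral_map (hk.comp hfm) measurable_fst
    rw [← hf, h0]
    have h1 : ∫⁻ x, ENNReal.ofReal
        (InformationTheory.klFun ((M.withDensity g).rnDeriv M x).toReal) ∂M
        = ∫⁻ x, ENNReal.ofReal (InformationTheory.klFun (g x).toReal) ∂M := by
      refine lintegral_congr_ae ?_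
      filter_upwards [Measure.rnDeriv_withDensity M hgm] with x hx
      rw [hx]
    rw [h1, ← lintegral_add_compl _ hS,
      setLIntegral_congr_fun (g := fun p => ENNReal.ofReal (InformationTheory.klFun (f p.1).toReal))
        hS (fun p hp => by simp only [hgS p hp]),
      setLIntegral_congr_fun (g := fun _ => 0) hS.compl
        (fun p hp => by simp [hgSc p hp, InformationTheory.klFun_one])]
    simp
  · refine le_iInf fun n' => le_iInf fun hn' => le_iInf fun hR => ?_
    refine le_trans ?_ (relEnt_restrict_le n' M hS)
    rw [relEnt_eq_klDiv, relEnt_eq_klDiv]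
    conv_lhs => rw [← hR]
    exact InformationTheory.klDiv_map_le _ _ measurable_fst

end
end
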